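/- Let I be a nonempty finite set of positive integers, m = max(I), I⁻ = I ∖ {m}, and m⁻ = max(I⁻ ∪ {0}). Then for every 0 ≤ k ≤ m: c_k(I) = d(I⁻, m) − (−1)^{m−m⁻}·c_k(I⁻), where c_k(I⁻) = 0 for k > m⁻ and d(I⁻,m) is the number of permutations of {1,…,m} with descent set I⁻. -/

import Mathlib

/-- The descent set of a permutation of `{1,…,n}` (modeled on `Fin n`), as a set of
1-indexed positions `i ∈ {1, …, n-1}` with `π_i > π_{i+1}`. -/
noncomputable def descSet (n : ℕ) (π : Equiv.Perm (Fin n)) : Finset ℕ :=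
  @Finset.filter _
    (fun i => ∃ (h1 : i - 1 < n) (h2 : i < n), π ⟨i, h2⟩ < π ⟨i - 1, h1⟩)
    (Classical.decPred _) (Finset.Ioo 0 n)

/-- `dCount I n` is the number of permutations of `{1,…,n}` with descent set `I`. -/
noncomputable def dCount (I : Finset ℕ) (n : ℕ) : ℕ :=
  Nat.card {π : Equiv.Perm (Fin n) // descSet n π = I}

/-- `mI I = max (I ∪ {0})`. -/
def mI (I : Finset ℕ) : ℕ := I.sup id

/-- `IsCCoeff I c` says that `c` is the coefficient sequence of the descent polynomial
of `I` in the basis `{C(n+1,k)}_{k=0}^{m}` with signs `(−1)^{m−k}`, i.e.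
`d(I,n) = Σ_{k=0}^{m} (−1)^{m−k} c_k·C(n+1,k)` for all integers `n > m`,
together with `c_k = 0` for `k > m`.  (These conditions determine `c` uniquely.) -/
def IsCCoeff (I : Finset ℕ) (c : ℕ → ℚ) : Prop :=
  (∀ n : ℕ, mI I < n →
      (dCount I n : ℚ) =
        ∑ k ∈ Finset.range (mI I + 1),
          (-1 : ℚ) ^ (mI I - k) * c k * ((n + 1).choose k)) ∧
  (∀ k : ℕ, mI I < k → c k = 0)

theorem zero_notMem_descSet (n : ℕ) (π : Equiv.Perm (Fin n)) : 0 ∉ descSet n π := by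
  simp [descSet]

theorem succ_mem_descSet (n : ℕ) (π : Equiv.Perm (Fin n)) (i : ℕ) :
    i + 1 ∈ descSet n π ↔ ∃ h : i + 1 < n, π ⟨i + 1, h⟩ < π ⟨i, by omega⟩ := by
  simp only [descSet, Finset.mem_filter, Finset.mem_Ioo, Nat.add_sub_cancel]
  constructor
  · rintro ⟨_, h1, h2, h⟩
    exact ⟨h2, h⟩
  · rintro ⟨h2, h⟩
    exact ⟨⟨by omega, h2⟩, by omega, h2, h⟩

theorem compl_card_aux {m r : ℕ} (S : Finset (Fin (m + r))) (hS : S.card = m) :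
    Sᶜ.card = r := by
  rw [Finset.card_compl, hS]; simp

/-- Glue a permutation of the first `m` positions with values in `S`. -/
noncomputable def gluePerm {m r : ℕ} (S : Finset (Fin (m + r))) (hS : S.card = m)
    (σ : Equiv.Perm (Fin m)) : Equiv.Perm (Fin (m + r)) :=
  finSumFinEquiv.symm.trans ((Equiv.sumCongr σ (Equiv.refl (Fin r))).trans
    (finSumEquivOfFinset hS (compl_card_aux S hS)))

theorem gluePerm_castAdd {m r : ℕ} (S : Finset (Fin (m + r))) (hS : S.card = m)
    (σ : Equiv.Perm (Fin m)) (i : Fin m) :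
    gluePerm S hS σ (Fin.castAdd r i) = S.orderEmbOfFin hS (σ i) := by
  simp [gluePerm]

theorem gluePerm_natAdd {m r : ℕ} (S : Finset (Fin (m + r))) (hS : S.card = m)
    (σ : Equiv.Perm (Fin m)) (i : Fin r) :
    gluePerm S hS σ (Fin.natAdd m i) = Sᶜ.orderEmbOfFin (compl_card_aux S hS) i := by
  simp [gluePerm]

theorem descSet_gluePerm {m r : ℕ} (S : Finset (Fin (m + r))) (hS : S.card = m)
    (σ : Equiv.Perm (Fin m)) :
    (descSet (m + r) (gluePerm S hS σ)).erase m = descSet m σ := by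
  ext i
  rw [Finset.mem_erase]
  rcases i with _ | i
  · simp [zero_notMem_descSet]
  rw [succ_mem_descSet, succ_mem_descSet]
  rcases lt_trichotomy (i + 1) m with h | h | h
  · have e1 := gluePerm_castAdd S hS σ ⟨i + 1, h⟩
    have e2 := gluePerm_castAdd S hS σ ⟨i, by omega⟩
    simp only [Fin.castAdd_mk] at e1 e2
    constructor
    · rintro ⟨_, h1, h2⟩
      rw [e1, e2] at h2
      exact ⟨h, by simpa using h2⟩
    · rintro ⟨_, h2⟩
      refine ⟨by omega, by omega, ?_⟩
      rw [e1, e2]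
      simpa using h2
  · constructor
    · rintro ⟨h1, _⟩
      exact absurd h h1
    · rintro ⟨h1, _⟩
      omega
  · constructor
    · rintro ⟨_, h1, h2⟩
      exfalso
      obtain ⟨j, rfl⟩ : ∃ j, i = m + j := ⟨i - m, by omega⟩
      have e1 := gluePerm_natAdd S hS σ ⟨j + 1, by omega⟩
      have e2 := gluePerm_natAdd S hS σ ⟨j, by omega⟩
      simp only [Fin.natAdd_mk, ← add_assoc] at e1 e2
      rw [e1, e2] at h2
      simp at h2
    · rintro ⟨h1, _⟩
      omega

theorem image_gluePerm {m r : ℕ} (S : Finset (Fin (m + r))) (hS : S.card = m)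
    (σ : Equiv.Perm (Fin m)) :
    Finset.univ.image (fun i => gluePerm S hS σ (Fin.castAdd r i)) = S := by
  apply Finset.eq_of_subset_of_card_le
  · intro x hx
    simp only [Finset.mem_image, gluePerm_castAdd] at hx
    obtain ⟨i, _, rfl⟩ := hx
    exact Finset.orderEmbOfFin_mem _ _ _
  · rw [Finset.card_image_of_injective, hS]
    · simp
    · exact (gluePerm S hS σ).injective.comp (Fin.castAdd_injective m r)

theorem exists_gluePerm {m r : ℕ} (π : Equiv.Perm (Fin (m + r))) (J : Finset ℕ)
    (hJ : ∀ j ∈ J, j < m) (h : (descSet (m + r) π).erase m = J) :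
    ∃ (S : Finset (Fin (m + r))) (hS : S.card = m) (σ : Equiv.Perm (Fin m)),
      gluePerm S hS σ = π := by
  have hinj : Function.Injective (fun i => π (Fin.castAdd r i)) :=
    π.injective.comp (Fin.castAdd_injective m r)
  obtain ⟨S, hSdef⟩ : ∃ S, S = Finset.univ.image (fun i => π (Fin.castAdd r i)) := ⟨_, rfl⟩
  have hS : S.card = m := by
    rw [hSdef, Finset.card_image_of_injective _ hinj]; simp
  have hmem : ∀ i, π (Fin.castAdd r i) ∈ S := fun i => by
    rw [hSdef]; exact Finset.mem_image_of_mem _ (Finset.mem_univ _)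
  let f : Fin m → Fin m := fun i => (S.orderIsoOfFin hS).symm ⟨_, hmem i⟩
  have hf : Function.Injective f := by
    intro a b hab
    have := (S.orderIsoOfFin hS).symm.injective hab
    exact hinj (Subtype.ext_iff.mp this)
  let σ : Equiv.Perm (Fin m) := Equiv.ofBijective f (Finite.injective_iff_bijective.mp hf)
  refine ⟨S, hS, σ, ?_⟩
  have hmono : StrictMono (fun j : Fin r => π (Fin.natAdd m j)) := by
    rcases r with _ | r
    · intro a
      exact a.elim0
    rw [Fin.strictMono_iff_lt_succ]
    intro j
    have hne : Fin.natAdd m j.castSucc ≠ Fin.natAdd m j.succ := by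
      simp [Fin.ext_iff]
    have hnot : m + j + 1 ∉ descSet (m + (r + 1)) π := by
      intro hin
      have h3 : m + j + 1 ∈ J := by
        rw [← h, Finset.mem_erase]
        exact ⟨by omega, hin⟩
      have := hJ _ h3
      omega
    rw [succ_mem_descSet] at hnot
    push Not at hnot
    have h4 := hnot (by omega)
    exact lt_of_le_of_ne h4 (fun he => hne (π.injective he))
  have hcompl : ∀ j : Fin r, π (Fin.natAdd m j) ∈ Sᶜ := by
    intro j
    rw [Finset.mem_compl, hSdef, Finset.mem_image]
    rintro ⟨i, _, hi⟩
    have := congrArg Fin.val (π.injective hi)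
    simp at this
    omega
  have huniq := Finset.orderEmbOfFin_unique (compl_card_aux S hS) hcompl hmono
  ext1 x
  refine Fin.addCases (fun i => ?_) (fun j => ?_) x
  · rw [gluePerm_castAdd]
    change ((S.orderIsoOfFin hS) ((S.orderIsoOfFin hS).symm ⟨_, hmem i⟩) : Fin (m + r)) = _
    simp
  · rw [gluePerm_natAdd, ← huniq]

theorem card_erase (m r : ℕ) (J : Finset ℕ) (hJ : ∀ j ∈ J, j < m) :
    Nat.card {π : Equiv.Perm (Fin (m + r)) // (descSet (m + r) π).erase m = J} =
      (m + r).choose m * dCount J m := by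
  let F : {S : Finset (Fin (m + r)) // S.card = m} ×
      {σ : Equiv.Perm (Fin m) // descSet m σ = J} →
      {π : Equiv.Perm (Fin (m + r)) // (descSet (m + r) π).erase m = J} :=
    fun p => ⟨gluePerm p.1.1 p.1.2 p.2.1, by rw [descSet_gluePerm, p.2.2]⟩
  have hF : Function.Bijective F := by
    constructor
    · rintro ⟨⟨S, hS⟩, ⟨σ, hσ⟩⟩ ⟨⟨T, hT⟩, ⟨τ, hτ⟩⟩ hab
      have hab' : gluePerm S hS σ = gluePerm T hT τ := Subtype.ext_iff.mp hab
      have hST : S = T := by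
        rw [← image_gluePerm S hS σ, hab', image_gluePerm]
      subst hST
      have : σ = τ := by
        ext1 i
        have := congrArg (fun π => π (Fin.castAdd r i)) hab'
        simp only [gluePerm_castAdd] at this
        exact (S.orderEmbOfFin hS).injective this
      subst this
      rfl
    · rintro ⟨π, hπ⟩
      obtain ⟨S, hS, σ, rfl⟩ := exists_gluePerm π J hJ hπ
      exact ⟨⟨⟨S, hS⟩, ⟨σ, by rw [← hπ, descSet_gluePerm]⟩⟩, rfl⟩
  rw [← Nat.card_congr (Equiv.ofBijective F hF), Nat.card_prod, dCount]
  congr 1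
  rw [Nat.card_eq_fintype_card, Fintype.card_finset_len, Fintype.card_fin]

theorem dCount_rec (m r : ℕ) (J : Finset ℕ) (hJ : ∀ j ∈ J, j < m) :
    dCount (insert m J) (m + r) + dCount J (m + r) = (m + r).choose m * dCount J m := by
  classical
  have hmJ : m ∉ J := fun h => lt_irrefl _ (hJ m h)
  rw [← card_erase m r J hJ, dCount, dCount]
  have key : ∀ D : Finset ℕ, D.erase m = J ↔ (D = insert m J ∨ D = J) := by
    intro D
    constructor
    · rintro rfl
      by_cases h : m ∈ D
      · left; rw [Finset.insert_erase h]
      · right; rw [Finset.erase_eq_of_notMem h]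
    · rintro (rfl | rfl)
      · exact Finset.erase_insert hmJ
      · exact Finset.erase_eq_of_notMem hmJ
  simp only [key, Nat.card_eq_fintype_card]
  rw [Fintype.card_subtype_or_disjoint]
  rw [Pi.disjoint_iff]
  intro π
  rw [Prop.disjoint_iff]
  rintro ⟨h', h⟩
  rw [h] at h'
  exact hmJ (h' ▸ Finset.mem_insert_self m J)

theorem choose_alt (n m : ℕ) :
    (n.choose m : ℚ) =
      ∑ k ∈ Finset.range (m + 1), (-1 : ℚ) ^ (m - k) * ((n + 1).choose k) := by
  induction m with
  | zero => simp
  | succ m ih =>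
    rw [Finset.sum_range_succ]
    have : ∀ k ∈ Finset.range (m + 1), (-1 : ℚ) ^ (m + 1 - k) * ((n + 1).choose k)
        = - ((-1 : ℚ) ^ (m - k) * ((n + 1).choose k)) := by
      intro k hk
      rw [Finset.mem_range] at hk
      rw [show m + 1 - k = (m - k) + 1 by omega, pow_succ]
      ring
    rw [Finset.sum_congr rfl this, Finset.sum_neg_distrib, ← ih, Nat.choose_succ_succ]
    push_cast
    simp

theorem choose_indep (M : ℕ) : ∀ (a : ℕ → ℚ) (N : ℕ),
    (∀ n, N ≤ n → ∑ k ∈ Finset.range (M + 1), a k * (n.choose k) = 0) →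
    ∀ k, k ≤ M → a k = 0 := by
  induction M with
  | zero =>
    intro a N h k hk
    have := h N le_rfl
    obtain rfl : k = 0 := by omega
    simpa using this
  | succ M ih =>
    intro a N h k hk
    have h1 : ∀ k, k ≤ M → a (k + 1) = 0 := by
      apply ih (fun k => a (k + 1)) N
      intro n hn
      have e1 := h n hn
      have e2 := h (n + 1) (by omega)
      rw [Finset.sum_range_succ'] at e1 e2
      simp only [Nat.choose_succ_succ n, Nat.cast_add, mul_add, Finset.sum_add_distrib,
        Nat.succ_eq_add_one, Nat.choose_zero_right] at e1 e2
      linarith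
    rcases k with _ | k
    · have e1 := h N le_rfl
      rw [Finset.sum_range_succ', Finset.sum_eq_zero] at e1
      · simpa using e1
      · intro k hk
        rw [Finset.mem_range] at hk
        rw [h1 k (by omega), zero_mul]
    · exact h1 k (by omega)

/-- For nonempty `I` with `m = max I`, `I⁻ = I ∖ {m}` and
`m⁻ = max(I⁻ ∪ {0})`: for every `0 ≤ k ≤ m`,
`c_k(I) = d(I⁻, m) − (−1)^{m−m⁻}·c_k(I⁻)`. -/
theorem stmt4 (I : Finset ℕ) (hI : I.Nonempty) (hpos : ∀ i ∈ I, 0 < i)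
    (c c' : ℕ → ℚ) (hc : IsCCoeff I c) (hc' : IsCCoeff (I.erase (mI I)) c') :
    ∀ k : ℕ, k ≤ mI I →
      c k = (dCount (I.erase (mI I)) (mI I) : ℚ)
        - (-1 : ℚ) ^ (mI I - mI (I.erase (mI I))) * c' k := by
  obtain ⟨m, hm⟩ : ∃ m, m = mI I := ⟨_, rfl⟩
  obtain ⟨J, hJ⟩ : ∃ J, J = I.erase (mI I) := ⟨_, rfl⟩
  have hmI : m ∈ I := by
    obtain ⟨i, hi, hi'⟩ := Finset.exists_mem_eq_sup I hI id
    have : m = i := by rw [hm]; exact hi'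
    rw [this]; exact hi
  have hmpos := hpos m hmI
  rw [← hJ] at hc' ⊢
  rw [← hm] at hJ ⊢
  have hJlt : ∀ j ∈ J, j < m := by
    intro j hj
    rw [hJ, Finset.mem_erase] at hj
    have : j ≤ m := by rw [hm]; exact Finset.le_sup (f := id) hj.2
    omega
  have hIJ : I = insert m J := by rw [hJ, Finset.insert_erase hmI]
  have hmJ : mI J < m := by
    rw [mI, Finset.sup_lt_iff (by simpa using hmpos)]
    exact hJlt
  obtain ⟨hc1, -⟩ := hc
  obtain ⟨hc1', hc2'⟩ := hc'
  rw [← hm] at hc1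
  have hext : ∀ n : ℕ, mI J < n → (dCount J n : ℚ) =
      ∑ k ∈ Finset.range (m + 1),
        (-1 : ℚ) ^ (m - k) * ((-1 : ℚ) ^ (m - mI J) * c' k) * ((n + 1).choose k) := by
    intro n hn
    rw [hc1' n hn]
    have hsub : Finset.range (mI J + 1) ⊆ Finset.range (m + 1) := by
      apply Finset.range_subset_range.mpr; omega
    rw [← Finset.sum_subset hsub]
    · apply Finset.sum_congr rfl
      intro k hk
      rw [Finset.mem_range] at hk
      rw [show m - k = (m - mI J) + (mI J - k) by omega, pow_add]
      have : (-1 : ℚ) ^ (m - mI J) * (-1 : ℚ) ^ (m - mI J) = 1 := by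
        rw [← mul_pow]; simp
      linear_combination (-(-1 : ℚ) ^ (mI J - k) * c' k * ((n + 1).choose k)) * this
    · intro k _ hk
      rw [Finset.mem_range] at hk
      rw [hc2' k (by omega)]
      ring
  have hzero := choose_indep m (fun k => (-1 : ℚ) ^ (m - k) *
    (c k - ((dCount J m : ℚ) - (-1 : ℚ) ^ (m - mI J) * c' k))) (m + 2) (by
      intro n' hn'
      obtain ⟨r, rfl⟩ : ∃ r, n' = m + r + 1 := ⟨n' - m - 1, by omega⟩
      have e1 := hc1 (m + r) (by omega)
      have e2 := hext (m + r) (by omega)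
      have e3 := dCount_rec m r J hJlt
      rw [← hIJ] at e3
      have e4 : (dCount I (m + r) : ℚ) + dCount J (m + r) =
        (m + r).choose m * dCount J m := by exact_mod_cast e3
      rw [choose_alt, e1, e2, Finset.sum_mul, ← Finset.sum_add_distrib, ← sub_eq_zero,
        ← Finset.sum_sub_distrib] at e4
      rw [← e4]
      apply Finset.sum_congr rfl
      intro k _
      ring)
  intro k hk
  have := hzero k hk
  rcases mul_eq_zero.mp this with h | h
  · exact absurd h (pow_ne_zero _ (by norm_num))
  · linarith
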